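/- Fix λ > 0 and suppose 0 < τ_min < T. If C_d > (1 − (1 + λ T) e^{−λ T})/λ, then the defender's best response to λ is to stop migrations, i.e., τ* = T: u_d(T, λ) > u_d(τ, λ) for every τ ∈ [τ_min, T). -/

import Mathlib

open MeasureTheory Set Real

/-- Attacker payoff in the specific instantiation `G(τ_d,τ_a) = τ_d − τ_a`,
`f(τ_a; λ) = λ e^{−λ τ_a}`: `u_a(τ_d, λ) = τ_d − ∫₀^{τ_d} e^{−λ s} ds − λ C_a`. -/
noncomputable def uaExp (Ca τd l : ℝ) : ℝ :=
  τd - (∫ s in (0:ℝ)..τd, Real.exp (-l * s)) - l * Ca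

/-- Defender payoff in the specific instantiation:
`u_d(τ_d, λ) = −(τ_d − ∫₀^{τ_d} e^{−λ s} ds + C_d)/τ_d`. -/
noncomputable def udExp (Cd τd l : ℝ) : ℝ :=
  -(τd - (∫ s in (0:ℝ)..τd, Real.exp (-l * s)) + Cd) / τd

theorem integral_exp_neg_mul {l : ℝ} (hl : l ≠ 0) (t : ℝ) :
    ∫ s in (0:ℝ)..t, Real.exp (-l * s) = (1 - Real.exp (-l * t)) / l := by
  rw [intervalIntegral.integral_comp_mul_left (fun x => Real.exp x) (neg_ne_zero.mpr hl),
    integral_exp, mul_zero, Real.exp_zero, smul_eq_mul]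
  field_simp
  ring

/-- The tangent line at `T` lies above the concave function `t ↦ (1 - exp (-l * t)) / l`. -/
theorem one_sub_exp_div_le_tangent {l : ℝ} (hl : 0 < l) (t T : ℝ) :
    (1 - Real.exp (-l * t)) / l ≤
      (1 - Real.exp (-l * T)) / l - (T - t) * Real.exp (-l * T) := by
  have hexp : Real.exp (-l * t) = Real.exp (-l * T) * Real.exp (l * (T - t)) := by
    rw [← Real.exp_add]
    ring_nf
  have hone := mul_le_mul_of_nonneg_left (Real.add_one_le_exp (l * (T - t)))
    (Real.exp_pos (-l * T)).le
  rw [← hexp] at hone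
  rw [div_le_iff₀ hl, sub_mul, div_mul_cancel₀ _ hl.ne']
  linarith

/-- Theorem (defender cost bound, specific instantiation): if
`C_d > (1 − (1 + λ T) e^{−λ T})/λ`, then the defender's best response to `λ` is to stop
migrations, i.e. `τ* = T`. -/
theorem defender_cost_bound_specific
    (τmin T l Cd : ℝ)
    (hl : 0 < l) (hτmin : 0 < τmin) (hτT : τmin < T)
    (hCd : (1 - (1 + l * T) * Real.exp (-l * T)) / l < Cd) :
    ∀ τ ∈ Ico τmin T, udExp Cd τ l < udExp Cd T l := by
  rintro τ ⟨hτ, hτlt⟩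
  have hτpos : 0 < τ := hτmin.trans_le hτ
  have hTpos : 0 < T := hτpos.trans hτlt
  have htangent := one_sub_exp_div_le_tangent hl τ T
  have hcost : (1 - Real.exp (-l * T)) / l - T * Real.exp (-l * T) < Cd := by
    convert hCd using 1
    field_simp
    ring
  unfold udExp
  rw [integral_exp_neg_mul hl.ne', integral_exp_neg_mul hl.ne', div_lt_div_iff₀ hτpos hTpos]
  linarith [mul_le_mul_of_nonneg_left htangent hTpos.le,
    mul_lt_mul_of_pos_left hcost (sub_pos.mpr hτlt)]
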